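/- arXiv:2507.07596 — 2 statements merged into one kernel-verified Lean document; each statement's English description precedes it below -/
import Mathlib

section
/- Let W = [m] and I_1, …, I_n ⊆ [m] with I_1 ∪ ⋯ ∪ I_n = [m]. Consider the optimization problem: minimize Σ_{j=1}^n x_j over x ∈ ℝ^n subject to max_{j : i ∈ I_j} x_j ≥ 1 for every i ∈ [m] and x_j ≥ 0 for every j ∈ [n]. Then the minimum value of this problem equals the minimum cardinality of a subfamily {I_{j₁}, …, I_{j_q}} with I_{j₁} ∪ ⋯ ∪ I_{j_q} = [m] (a minimum set cover). In particular, every optimal solution x satisfies x ∈ {0,1}^n, a vector x ∈ {0,1}^n is feasible if and only if {I_j : x_j = 1} is a set cover of [m], and then Σ_j x_j equals the cardinality of that cover. -/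
attribute [local instance] Classical.propDecidable

/-- Feasibility for the set-cover program: `x ≥ 0` and, for every ground element
`i ∈ [m]`, `max_{j : i ∈ I_j} x_j ≥ 1`. -/
def SCFeas {m n : ℕ} (I : Fin n → Finset (Fin m)) (x : Fin n → ℝ) : Prop :=
  (∀ j, 0 ≤ x j) ∧ ∀ i : Fin m, ∃ j, i ∈ I j ∧ 1 ≤ x j

/-- A nonnegative vector `x` dominates the indicator of `{j | 1 ≤ x j}`. -/
theorem indicator_one_le_of_nonneg {ι : Type*} (x : ι → ℝ) (hx : ∀ j, 0 ≤ x j) (j : ι) :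
    (if 1 ≤ x j then (1 : ℝ) else 0) ≤ x j := by
  split_ifs with h
  exacts [h, hx j]

/-- The indices at which a feasible vector is at least one form a set cover, so the minimum
size of a cover is at most their number. -/
theorem SCFeas.sInf_card_le_sum_indicator {m n : ℕ} {I : Fin n → Finset (Fin m)} {x : Fin n → ℝ}
    (hx : SCFeas I x) :
    ((sInf {q : ℕ | ∃ Js : Finset (Fin n), (∀ i : Fin m, ∃ j ∈ Js, i ∈ I j) ∧
      q = Js.card} : ℕ) : ℝ) ≤ ∑ j, if 1 ≤ x j then (1 : ℝ) else 0 := by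
  rw [Finset.sum_boole]
  refine Nat.cast_le.mpr (Nat.sInf_le ⟨_, fun i => ?_, rfl⟩)
  obtain ⟨j, hij, hj⟩ := hx.2 i
  exact ⟨j, by simpa using hj, hij⟩

/-- the minimum value of
`min Σ_j x_j  s.t.  max_{j : i ∈ I_j} x_j ≥ 1 (i ∈ [m]), x ≥ 0`
equals the minimum cardinality of a set cover; every optimal solution is a `0/1` vector;
a `0/1` vector is feasible iff `{I_j : x_j = 1}` is a set cover of `[m]`; and the
objective value of a `0/1` vector is the cardinality of `{j : x_j = 1}`. -/
theorem stmt15 {m n : ℕ} (I : Fin n → Finset (Fin m)) (hcov : ∀ i : Fin m, ∃ j, i ∈ I j) :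
    IsLeast {v : ℝ | ∃ x : Fin n → ℝ, SCFeas I x ∧ v = ∑ j, x j}
      ((sInf {q : ℕ | ∃ Js : Finset (Fin n), (∀ i : Fin m, ∃ j ∈ Js, i ∈ I j) ∧
          q = Js.card} : ℕ) : ℝ) ∧
    (∀ x : Fin n → ℝ, SCFeas I x →
      (∑ j, x j) = ((sInf {q : ℕ | ∃ Js : Finset (Fin n), (∀ i : Fin m, ∃ j ∈ Js, i ∈ I j) ∧
          q = Js.card} : ℕ) : ℝ) →
      ∀ j, x j = 0 ∨ x j = 1) ∧
    (∀ x : Fin n → ℝ, (∀ j, x j = 0 ∨ x j = 1) →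
      (SCFeas I x ↔ ∀ i : Fin m, ∃ j, x j = 1 ∧ i ∈ I j)) ∧
    (∀ x : Fin n → ℝ, (∀ j, x j = 0 ∨ x j = 1) →
      (∑ j, x j) = ((Finset.univ.filter fun j => x j = 1).card : ℝ)) := by
  refine ⟨⟨?_, ?_⟩, ?_, ?_, ?_⟩
  · obtain ⟨Js, hJs, hq⟩ := Nat.sInf_mem
      (s := {q : ℕ | ∃ Js : Finset (Fin n), (∀ i : Fin m, ∃ j ∈ Js, i ∈ I j) ∧ q = Js.card})
      ⟨_, Finset.univ, fun i => (hcov i).imp fun j hj => ⟨Finset.mem_univ j, hj⟩, rfl⟩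
    refine ⟨fun j => if j ∈ Js then 1 else 0, ⟨fun j => ?_, fun i => ?_⟩, ?_⟩
    · dsimp only
      split_ifs <;> norm_num
    · obtain ⟨j, hj, hij⟩ := hJs i
      exact ⟨j, hij, by simp [hj]⟩
    · rw [hq]
      simp
  · rintro v ⟨x, hx, rfl⟩
    exact hx.sInf_card_le_sum_indicator.trans
      (Finset.sum_le_sum fun j _ => indicator_one_le_of_nonneg x hx.1 j)
  · intro x hx hopt j
    have hle := fun j (_ : j ∈ Finset.univ) => indicator_one_le_of_nonneg x hx.1 j
    have heq := (Finset.sum_eq_sum_iff_of_le hle).mp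
      ((Finset.sum_le_sum hle).antisymm (hopt.trans_le hx.sInf_card_le_sum_indicator))
      j (Finset.mem_univ j)
    split_ifs at heq
    exacts [Or.inr heq.symm, Or.inl heq.symm]
  · refine fun x h01 => ⟨fun hx i => ?_, fun hx => ⟨fun j => ?_, fun i => ?_⟩⟩
    · obtain ⟨j, hij, hj⟩ := hx.2 i
      exact ⟨j, (h01 j).resolve_left fun h0 => by linarith, hij⟩
    · rcases h01 j with h | h <;> norm_num [h]
    · obtain ⟨j, hj, hij⟩ := hx i
      exact ⟨j, hij, hj.ge⟩
  · intro x h01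
    rw [← Finset.sum_boole]
    refine Finset.sum_congr rfl fun j _ => ?_
    rcases h01 j with h | h <;> simp [h]
end

section
/- Let A⁺, A⁻ ∈ ℝ_max^{m×n}, b⁺, b⁻ ∈ ℝ_max^m, C ∈ ℝ_max^{p×n}, d ∈ ℝ_max^p, μ⁺ ∈ ℤ_+^p, μ⁻ ∈ ℤ_+^n, and set ν = Σ_j μ⁻_j − Σ_k μ⁺_k. Define the homogenized data Ã± = [A± b±] ∈ ℝ_max^{m×(n+1)}, C̃ ∈ ℝ_max^{(p+1)×(n+1)} obtained from [C d] by appending the row (−∞, …, −∞, 0), μ̃⁺ = (μ⁺, max(ν,0)) ∈ ℤ_+^{p+1}, and μ̃⁻ = (μ⁻, max(−ν,0)) ∈ ℤ_+^{n+1}. Then: (1) x ∈ ℝ_max^n satisfies A⁺ ⊗ x ⊕ b⁺ ≥ A⁻ ⊗ x ⊕ b⁻ if and only if the vector (x, 0) ∈ ℝ_max^{n+1} satisfies Ã⁺ ⊗ (x,0) ≥ Ã⁻ ⊗ (x,0); (2) for every x̃ = (x, x_{n+1}) ∈ ℝ_max^{n+1} with x_{n+1} ∈ ℝ, the homogenized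 objective Σ_k μ̃⁺_k (C̃ ⊗ x̃)_k − Σ_j μ̃⁻_j x̃_j equals the inhomogeneous objective Σ_k μ⁺_k (C ⊗ x' ⊕ d)_k − Σ_j μ⁻_j x'_j evaluated at x' = x − x_{n+1}·𝟙. -/
/-- The tropical semiring `ℝ_max = ℝ ∪ {-∞}`. -/
abbrev Rmax : Type := WithBot ℝ

/-- Tropical matrix-vector product for a vector with entries in `ℝ_max`:
`(A ⊗ x)_i = max_j (a_{i,j} + x_j)`. -/
def tmvB {m n : ℕ} (A : Fin m → Fin n → Rmax) (x : Fin n → Rmax) (i : Fin m) : Rmax :=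
  Finset.univ.sup fun j => A i j + x j

theorem tmvB_succ {m n : ℕ} (A : Fin m → Fin (n + 1) → Rmax) (x : Fin (n + 1) → Rmax) (i : Fin m) :
    tmvB A x i = tmvB (fun i j => A i j.castSucc) (fun j => x j.castSucc) i ⊔
      (A i (Fin.last n) + x (Fin.last n)) := by
  simp only [tmvB, Fin.univ_castSuccEmb, Finset.sup_cons, Finset.sup_map]
  rw [sup_comm]
  rfl

theorem tmvB_add_const {m n : ℕ} (A : Fin m → Fin n → Rmax) (x : Fin n → Rmax) (c : Rmax)
    (i : Fin m) : tmvB A (fun j => x j + c) i = tmvB A x i + c := by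
  have h := Finset.apply_sup_eq_sup_comp_of_linearOrder (s := Finset.univ)
    (f := fun j => A i j + x j) (fun y : Rmax => y + c)
    (fun _ _ h => add_le_add_left h c) (WithBot.bot_add c)
  simp only [tmvB, h, Function.comp_def, add_assoc]

theorem tmvB_snoc {m n : ℕ} (A : Fin m → Fin n → Rmax) (b : Fin m → Rmax)
    (x : Fin n → Rmax) (c : Rmax) (i : Fin m) :
    tmvB (fun i' => Fin.snoc (A i') (b i')) (Fin.snoc x c) i = tmvB A x i ⊔ (b i + c) := by
  simp [tmvB_succ]

/-- homogenization of an inhomogeneous TLFacP.  With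
`ν = Σ_j μ⁻_j − Σ_k μ⁺_k`, `Ã± = [A± b±]`, `C̃` obtained from `[C d]` by appending the
row `(-∞,…,-∞,0)`, `μ̃⁺ = (μ⁺, max(ν,0))`, `μ̃⁻ = (μ⁻, max(−ν,0))`:
(1) `x` satisfies `A⁺⊗x ⊕ b⁺ ≥ A⁻⊗x ⊕ b⁻` iff `(x,0)` satisfies `Ã⁺⊗(x,0) ≥ Ã⁻⊗(x,0)`;
(2) for `xt = (x, x_{n+1})` with `x_{n+1} ∈ ℝ`, the homogenized objective
`Σ_k μ̃⁺_k (C̃⊗xt)_k − Σ_j μ̃⁻_j xt_j` equals the inhomogeneous objective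
`Σ_k μ⁺_k (C⊗x' ⊕ d)_k − Σ_j μ⁻_j x'_j` at `x' = x − x_{n+1}·𝟙` (stated additively,
with both subtracted sums moved to the opposite sides, so that the identity also makes
sense for vectors with `-∞` entries). -/
theorem stmt16 {m p n : ℕ} (Ap Am : Fin m → Fin n → Rmax) (bp bm : Fin m → Rmax)
    (C : Fin p → Fin n → Rmax) (d : Fin p → Rmax) (μp : Fin p → ℕ) (μm : Fin n → ℕ) :
    (∀ x : Fin n → Rmax,
      ((∀ i, tmvB Am x i ⊔ bm i ≤ tmvB Ap x i ⊔ bp i) ↔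
        (∀ i, tmvB (fun i' => Fin.snoc (Am i') (bm i')) (Fin.snoc x 0) i ≤
              tmvB (fun i' => Fin.snoc (Ap i') (bp i')) (Fin.snoc x 0) i))) ∧
    (∀ (xt : Fin (n + 1) → Rmax) (xl : ℝ), xt (Fin.last n) = (xl : ℝ) →
      (∑ k : Fin (p + 1),
          (Fin.snoc (α := fun _ => ℕ) μp (((∑ j, (μm j : ℤ)) - ∑ k, (μp k : ℤ)).toNat) k) •
            tmvB (Fin.snoc (fun k' => Fin.snoc (C k') (d k'))
              (Fin.snoc (fun _ : Fin n => (⊥ : Rmax)) (0 : Rmax))) xt k) +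
        (∑ j : Fin n, (μm j • ((xt j.castSucc + ((-xl : ℝ) : Rmax)) : Rmax) : Rmax)) =
      (∑ k : Fin p,
          μp k • (tmvB C (fun j => xt j.castSucc + ((-xl : ℝ) : Rmax)) k ⊔ d k)) +
        (∑ j : Fin (n + 1),
          (Fin.snoc (α := fun _ => ℕ) μm ((-((∑ j', (μm j' : ℤ)) - ∑ k, (μp k : ℤ))).toNat) j) • xt j)) := by
  refine ⟨fun x => by simp [tmvB_snoc], fun xt xl hx => ?_⟩
  obtain ⟨x', hx'⟩ : ∃ x' : Fin n → Rmax, ∀ j, xt j.castSucc + ((-xl : ℝ) : Rmax) = x' j :=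
    ⟨_, fun _ => rfl⟩
  have hxt : ∀ j : Fin n, xt j.castSucc = x' j + (xl : Rmax) := fun j => by
    rw [← hx', add_assoc, ← WithBot.coe_add, neg_add_cancel, WithBot.coe_zero, add_zero]
  simp only [hx']
  have hrow : ∀ k : Fin p, tmvB (Fin.snoc (fun k' => Fin.snoc (C k') (d k'))
      (Fin.snoc (fun _ : Fin n => (⊥ : Rmax)) (0 : Rmax))) xt k.castSucc =
      (tmvB C x' k ⊔ d k) + (xl : Rmax) := fun k => by
    rw [tmvB_succ, max_add, ← tmvB_add_const]
    simp [tmvB, hxt, hx]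
  have hlast : tmvB (Fin.snoc (fun k' => Fin.snoc (C k') (d k'))
      (Fin.snoc (fun _ : Fin n => (⊥ : Rmax)) (0 : Rmax))) xt (Fin.last p) = (xl : Rmax) := by
    rw [tmvB_succ]
    simp [tmvB, hx]
  have hν : ∑ k, μp k + ((∑ j, (μm j : ℤ)) - ∑ k, (μp k : ℤ)).toNat =
      ∑ j, μm j + (-((∑ j, (μm j : ℤ)) - ∑ k, (μp k : ℤ))).toNat := by
    simp only [← Nat.cast_sum]
    lia
  have hsmul := congrArg (· • (xl : Rmax)) hν
  simp only [add_smul, Finset.sum_smul] at hsmul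
  simp only [Fin.sum_univ_castSucc, Fin.snoc_castSucc, Fin.snoc_last, hrow, hlast, hxt, hx,
    smul_add, Finset.sum_add_distrib]
  rw [add_assoc (∑ k, μp k • (tmvB C x' k ⊔ d k)), hsmul]
  abel
end
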